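/- arXiv:2604.09491 — 3 statements merged into one kernel-verified Lean document; each statement's English description precedes it below -/
import Mathlib

section
/- Let p and q be distinct odd primes, n = p²q³, and D* = {1, p², pq, q², p²q², pq³}. Then for all a ∈ {0,1,2} and b ∈ {0,1,2}, the eigenvalue λ_{p^a q^b}(D*) = ∑_{d ∈ D*} c(p^a q^b, n/d) equals α_a · S_b(q), where α_0 = -2, α_1 = 2(p-1), α_2 = -(p²-2p+2), and S_b(q) = ∑_{k=0}^{b} (-q)^k (so S_0 = 1, S_1 = 1-q, S_2 = 1-q+q²); the equality is in ℂ with the integer right-hand side coerced. -/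
/-- The Ramanujan sum `c(j, m) = ∑_{a=1, gcd(a,m)=1}^{m} exp(2πi·a·j/m)`. -/
noncomputable def ramanujanSum (j m : ℕ) : ℂ :=
  ∑ a ∈ (Finset.Icc 1 m).filter (fun a => Nat.gcd a m = 1),
    Complex.exp (2 * (Real.pi : ℂ) * Complex.I * (a : ℂ) * (j : ℂ) / (m : ℂ))

/-- The divisor set `D* = {1, p², pq, q², p²q², pq³}`. -/
def Dstar (p q : ℕ) : Finset ℕ :=
  {1, p ^ 2, p * q, q ^ 2, p ^ 2 * q ^ 2, p * q ^ 3}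

/-- The eigenvalue `λ_e(D*) = ∑_{d ∈ D*} c(e, n/d)` of `ICG(p²q³, D*)`. -/
noncomputable def lamStar (p q e : ℕ) : ℂ :=
  ∑ d ∈ Dstar p q, ramanujanSum e (p ^ 2 * q ^ 3 / d)

/-- `α_0 = -2`, `α_1 = 2(p-1)`, `α_2 = -(p²-2p+2)`. -/
def alphaCoeff (p : ℤ) : ℕ → ℤ
  | 0 => -2
  | 1 => 2 * (p - 1)
  | _ => -(p ^ 2 - 2 * p + 2)

/-- The partial alternating geometric sum `S_b(q) = ∑_{k=0}^{b} (-q)^k`. -/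
def Ssum (q : ℤ) (b : ℕ) : ℤ := ∑ k ∈ Finset.range (b + 1), (-q) ^ k


lemma aux_full (j m : ℕ) (hm : 0 < m) :
    ∑ a ∈ Finset.Icc 1 m, Complex.exp (2 * (Real.pi : ℂ) * Complex.I * (a : ℂ) * (j : ℂ) / (m : ℂ))
      = if m ∣ j then (m : ℂ) else 0 := by
  have hm0 : (m : ℂ) ≠ 0 := by exact_mod_cast hm.ne'
  have hprim := Complex.isPrimitiveRoot_exp m hm.ne'
  set z := Complex.exp (2 * (Real.pi : ℂ) * Complex.I / (m : ℂ)) with hz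
  have hterm : ∀ a : ℕ, Complex.exp (2 * (Real.pi : ℂ) * Complex.I * (a : ℂ) * (j : ℂ) / (m : ℂ))
      = (z ^ j) ^ a := by
    intro a
    rw [hz, ← Complex.exp_nat_mul, ← Complex.exp_nat_mul]
    congr 1
    ring
  simp_rw [hterm]
  split_ifs with h
  · rw [(hprim.pow_eq_one_iff_dvd j).2 h]
    simp
  · have h1 : z ^ j ≠ 1 := fun h' => h ((hprim.pow_eq_one_iff_dvd j).1 h')
    have h2 : (z ^ j) ^ m = 1 := by rw [← pow_mul, mul_comm, pow_mul, hprim.pow_eq_one, one_pow]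
    have h3 : ∑ a ∈ Finset.Icc 1 m, (z ^ j) ^ a = (z ^ j) * ∑ a ∈ Finset.range m, (z ^ j) ^ a := by
      rw [Finset.mul_sum, Finset.range_eq_Ico, ← Finset.Ico_add_one_right_eq_Icc,
        Finset.sum_Ico_eq_sum_range, Finset.range_eq_Ico]
      refine Finset.sum_congr (by simp) fun a _ => ?_
      rw [pow_add, pow_one]
    rw [h3, geom_sum_eq h1, h2]
    simp

lemma aux_div (j m : ℕ) (hm : 0 < m) :
    ∑ d ∈ m.divisors, ramanujanSum j d = if m ∣ j then (m : ℂ) else 0 := by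
  rw [← aux_full j m hm, ← Nat.sum_div_divisors,
    ← Finset.sum_fiberwise_of_maps_to (s := Finset.Icc 1 m) (t := m.divisors)
      (g := fun a => Nat.gcd a m)
      (fun a _ => Nat.mem_divisors.2 ⟨Nat.gcd_dvd_right a m, hm.ne'⟩)]
  refine Finset.sum_congr rfl fun d hd => ?_
  obtain ⟨k, rfl⟩ := (Nat.mem_divisors.1 hd).1
  have hd0 : 0 < d := Nat.pos_of_mul_pos_right hm
  have hk0 : 0 < k := Nat.pos_of_mul_pos_left hm
  rw [Nat.mul_div_cancel_left _ hd0]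
  unfold ramanujanSum
  refine Finset.sum_bij (fun a _ => d * a) ?_ ?_ ?_ ?_
  · intro a ha
    simp only [Finset.mem_filter, Finset.mem_Icc] at ha ⊢
    refine ⟨⟨Nat.mul_pos hd0 ha.1.1, Nat.mul_le_mul_left d ha.1.2⟩, ?_⟩
    rw [Nat.gcd_mul_left, ha.2, mul_one]
  · intro a _ b _ h
    exact Nat.eq_of_mul_eq_mul_left hd0 h
  · intro b hb
    simp only [Finset.mem_filter, Finset.mem_Icc] at hb
    obtain ⟨⟨h1, h2⟩, h3⟩ := hb
    obtain ⟨c, rfl⟩ : d ∣ b := h3 ▸ Nat.gcd_dvd_left b (d * k)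
    refine ⟨c, ?_, rfl⟩
    simp only [Finset.mem_filter, Finset.mem_Icc]
    refine ⟨⟨Nat.pos_of_mul_pos_left h1, Nat.le_of_mul_le_mul_left h2 hd0⟩, ?_⟩
    rw [Nat.gcd_mul_left] at h3
    exact Nat.eq_of_mul_eq_mul_left hd0 (by rw [h3, mul_one])
  · intro a _
    congr 1
    have : (d : ℂ) ≠ 0 := by exact_mod_cast hd0.ne'
    have : (k : ℂ) ≠ 0 := by exact_mod_cast hk0.ne'
    push_cast
    field_simp

lemma aux_grid (p q : ℕ) (hp : p.Prime) (hq : q.Prime) (hpq : p ≠ q) (a b i k : ℕ) :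
    ∑ x ∈ Finset.range (i + 1), ∑ y ∈ Finset.range (k + 1),
      ramanujanSum (p ^ a * q ^ b) (p ^ x * q ^ y)
      = (if i ≤ a then (p : ℂ) ^ i else 0) * (if k ≤ b then (q : ℂ) ^ k else 0) := by
  have hc : Nat.Coprime p q := (Nat.coprime_primes hp hq).2 hpq
  have h := aux_div (p ^ a * q ^ b) (p ^ i * q ^ k)
    (Nat.mul_pos (pow_pos hp.pos i) (pow_pos hq.pos k))
  have hdv : p ^ i * q ^ k ∣ p ^ a * q ^ b ↔ i ≤ a ∧ k ≤ b := by
    constructor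
    · intro h
      refine ⟨(Nat.pow_dvd_pow_iff_le_right hp.one_lt).1 ?_,
        (Nat.pow_dvd_pow_iff_le_right hq.one_lt).1 ?_⟩
      · exact (Nat.Coprime.pow i b hc).dvd_of_dvd_mul_right ((Dvd.intro _ rfl).trans h)
      · exact (Nat.Coprime.pow k a hc.symm).dvd_of_dvd_mul_left ((Dvd.intro_left _ rfl).trans h)
    · rintro ⟨h1, h2⟩
      exact mul_dvd_mul (pow_dvd_pow p h1) (pow_dvd_pow q h2)
  rw [Nat.divisors_mul, Finset.mul_def,
    Finset.sum_image (Nat.Coprime.mul_injOn_divisors (Nat.Coprime.pow i k hc)),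
    Finset.sum_product] at h
  simp only [Nat.sum_divisors_prime_pow hp, Nat.sum_divisors_prime_pow hq] at h
  rw [h]
  by_cases h1 : i ≤ a <;> by_cases h2 : k ≤ b <;> simp [hdv, h1, h2]

theorem stmt6 (p q : ℕ) (hp : p.Prime) (hq : q.Prime)
    (hpo : Odd p) (hqo : Odd q) (hpq : p ≠ q)
    (a b : ℕ) (ha : a ≤ 2) (hb : b ≤ 2) :
    lamStar p q (p ^ a * q ^ b)
      = ((alphaCoeff (p : ℤ) a * Ssum (q : ℤ) b : ℤ) : ℂ) := by
  have hc : Nat.Coprime p q := (Nat.coprime_primes hp hq).2 hpq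
  have hp0 := hp.pos
  have hq0 := hq.pos
  have hinj : ∀ x y x' y' : ℕ, p ^ x * q ^ y = p ^ x' * q ^ y' → x = x' ∧ y = y' := by
    have key : ∀ x y x' y' : ℕ, p ^ x * q ^ y ∣ p ^ x' * q ^ y' → x ≤ x' ∧ y ≤ y' := by
      intro x y x' y' h
      refine ⟨(Nat.pow_dvd_pow_iff_le_right hp.one_lt).1 ?_,
        (Nat.pow_dvd_pow_iff_le_right hq.one_lt).1 ?_⟩
      · exact (Nat.Coprime.pow x y' hc).dvd_of_dvd_mul_right ((Dvd.intro _ rfl).trans h)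
      · exact (Nat.Coprime.pow y x' hc.symm).dvd_of_dvd_mul_left ((Dvd.intro_left _ rfl).trans h)
    intro x y x' y' h
    have h1 := key x y x' y' h.dvd
    have h2 := key x' y' x y h.symm.dvd
    omega
  have hD : Dstar p q = ({(0, 0), (2, 0), (1, 1), (0, 2), (2, 2), (1, 3)} : Finset (ℕ × ℕ)).image
      (fun t => p ^ t.1 * q ^ t.2) := by
    simp [Dstar, Finset.image_insert]
  have hdiv : ∀ x y x' y' : ℕ, x + x' = 2 → y + y' = 3 →
      p ^ 2 * q ^ 3 / (p ^ x * q ^ y) = p ^ x' * q ^ y' := by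
    intro x y x' y' hx hy
    rw [← hx, ← hy]
    apply Nat.div_eq_of_eq_mul_right (Nat.mul_pos (pow_pos hp0 x) (pow_pos hq0 y))
    ring
  unfold lamStar
  rw [hD, Finset.sum_image (fun s _ t _ h => Prod.ext_iff.2 (hinj _ _ _ _ h))]
  rw [Finset.sum_insert (by decide), Finset.sum_insert (by decide), Finset.sum_insert (by decide),
    Finset.sum_insert (by decide), Finset.sum_insert (by decide), Finset.sum_singleton]
  simp only
  rw [hdiv 0 0 2 3 rfl rfl, hdiv 2 0 0 3 rfl rfl, hdiv 1 1 1 2 rfl rfl, hdiv 0 2 2 1 rfl rfl,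
    hdiv 2 2 0 1 rfl rfl, hdiv 1 3 1 0 rfl rfl]
  have G := aux_grid p q hp hq hpq a b
  generalize hg : (fun x y => ramanujanSum (p ^ a * q ^ b) (p ^ x * q ^ y)) = g at *
  have hg' : ∀ x y, ramanujanSum (p ^ a * q ^ b) (p ^ x * q ^ y) = g x y := fun x y => by rw [← hg]
  simp only [hg'] at G ⊢
  have h00 := G 0 0
  have h01 := G 0 1
  have h02 := G 0 2
  have h03 := G 0 3
  have h10 := G 1 0
  have h11 := G 1 1
  have h12 := G 1 2
  have h20 := G 2 0
  have h21 := G 2 1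
  have h22 := G 2 2
  have h13 := G 1 3
  have h23 := G 2 3
  simp only [Finset.sum_range_succ, Finset.sum_range_zero, zero_add] at h00 h01 h02 h03 h10 h11 h12 h20 h21 h22 h13 h23
  have key : g 2 3 + (g 0 3 + (g 1 2 + (g 2 1 + (g 0 1 + g 1 0)))) = 
     ((alphaCoeff (p : ℤ) a * Ssum (q : ℤ) b : ℤ) : ℂ) := by
    interval_cases a <;> interval_cases b <;>
    · simp [alphaCoeff, Ssum, Finset.sum_range_succ] at h00 h01 h02 h03 h10 h11 h12 h20 h21 h22 h13 h23 ⊢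
      linear_combination (h23 - h22 - h13 + h12) + (h03 - h02) + (h12 - h11 - h02 + h01)
        + (h21 - h20 - h11 + h10) + (h01 - h00) + (h10 - h00)
  exact key
end

section
/- Let p and q be distinct odd primes, n = p²q³, and D* = {1, p², pq, q², p²q², pq³}. Then the eigenvalue at the divisor pq³ satisfies λ_{pq³}(D*) = ∑_{d ∈ D*} c(pq³, n/d) = (p-1)(2 - 2q + 2q² - q³) (equality in ℂ with the integer right-hand side coerced). -/
lemma sum_range_blocks (g : ℕ → ℂ) (k N : ℕ) :
    ∑ a ∈ Finset.range (N * k), g a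
      = ∑ s ∈ Finset.range N, ∑ r ∈ Finset.range k, g (s * k + r) := by
  induction N with
  | zero => simp
  | succ N ih =>
    rw [Nat.succ_mul, Finset.sum_range_add, ih, Finset.sum_range_succ]

lemma sum_coprime_pow (z : ℂ) (k N : ℕ) :
    ∑ a ∈ Finset.range (N * k), (if Nat.gcd a k = 1 then z ^ a else 0)
      = (∑ s ∈ Finset.range N, (z ^ k) ^ s) *
        ∑ r ∈ Finset.range k, (if Nat.gcd r k = 1 then z ^ r else 0) := by
  rw [sum_range_blocks, Finset.sum_mul]
  refine Finset.sum_congr rfl fun s _ => ?_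
  rw [Finset.mul_sum]
  refine Finset.sum_congr rfl fun r _ => ?_
  have : Nat.gcd (s * k + r) k = Nat.gcd r k := by simp
  simp only [this]
  split_ifs
  · rw [pow_add, ← pow_mul, mul_comm k s]
  · simp

lemma sum_totient (k : ℕ) :
    ∑ r ∈ Finset.range k, (if Nat.gcd r k = 1 then (1 : ℂ) ^ r else 0) = (k.totient : ℂ) := by
  simp only [one_pow]
  rw [← Finset.sum_filter, Finset.sum_const, nsmul_eq_mul, mul_one, Nat.totient]
  congr 2
  ext a
  simp [Nat.Coprime, Nat.gcd_comm]

lemma ramanujan_eq (j m : ℕ) (z : ℂ)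
    (hz : z = Complex.exp (2 * (Real.pi : ℂ) * Complex.I * (j : ℂ) / (m : ℂ))) (hm : m ≠ 0) :
    ramanujanSum j m = ∑ a ∈ Finset.range m, (if Nat.gcd a m = 1 then z ^ a else 0) := by
  have hzm : z ^ m = 1 := by
    rw [hz, ← Complex.exp_nat_mul, Complex.exp_eq_one_iff]
    refine ⟨j, ?_⟩
    have : (m : ℂ) ≠ 0 := by exact_mod_cast hm
    push_cast
    field_simp
  have h1 : ramanujanSum j m
      = ∑ a ∈ Finset.Icc 1 m, (if Nat.gcd a m = 1 then z ^ a else 0) := by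
    rw [ramanujanSum, Finset.sum_filter]
    refine Finset.sum_congr rfl fun a _ => ?_
    rw [hz, ← Complex.exp_nat_mul]
    congr 2
    ring
  rw [h1]
  set g : ℕ → ℂ := fun a => if Nat.gcd a m = 1 then z ^ a else 0 with hg
  have h2 : ∑ a ∈ Finset.Icc 1 m, g a = ∑ a ∈ Finset.range m, g (a + 1) := by
    rw [Finset.range_eq_Ico, Finset.sum_Ico_add' g 0 m 1]
    rfl
  have h3 : g 0 = g m := by simp [hg, hzm]
  have h4 := Finset.sum_range_succ g m
  rw [Finset.sum_range_succ', h3] at h4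
  rw [h2]
  exact add_right_cancel h4

lemma ramanujan_dvd (j m : ℕ) (hm : m ≠ 0) (h : m ∣ j) :
    ramanujanSum j m = (m.totient : ℂ) := by
  rw [ramanujan_eq j m 1 _ hm, sum_totient]
  obtain ⟨t, rfl⟩ := h
  symm
  rw [Complex.exp_eq_one_iff]
  refine ⟨t, ?_⟩
  have : (m : ℂ) ≠ 0 := by exact_mod_cast hm
  push_cast
  field_simp

lemma ramanujan_sq (p k t : ℕ) (hp : p.Prime) (hk : p.Coprime k) (hk0 : k ≠ 0)
    (ht : p.Coprime t) :
    ramanujanSum (p * k * t) (p ^ 2 * k) = -(p : ℂ) * (k.totient : ℂ) := by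
  have hp0 : (p : ℂ) ≠ 0 := by exact_mod_cast hp.ne_zero
  have hkc : (k : ℂ) ≠ 0 := by exact_mod_cast hk0
  set ζ := Complex.exp (2 * (Real.pi : ℂ) * Complex.I / (p : ℂ)) with hζ
  have hprim : IsPrimitiveRoot ζ p := Complex.isPrimitiveRoot_exp p hp.ne_zero
  have hm : p ^ 2 * k ≠ 0 := mul_ne_zero (pow_ne_zero _ hp.ne_zero) hk0
  rw [ramanujan_eq _ _ (ζ ^ t) _ hm]
  swap
  · rw [hζ, ← Complex.exp_nat_mul]
    congr 1
    push_cast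
    field_simp
  have hzp : (ζ ^ t) ^ p = 1 := by
    rw [← pow_mul, mul_comm, pow_mul, hprim.pow_eq_one, one_pow]
  have hzk : (ζ ^ t) ^ k ≠ 1 := by
    rw [← pow_mul]
    intro h
    have hd := hprim.dvd_of_pow_eq_one _ h
    have := (Nat.Coprime.mul_right ht hk).eq_one_of_dvd hd
    exact hp.one_lt.ne' this
  set z := ζ ^ t
  -- the difference between the two coprimality conditions does not see z
  have key : ∀ w : ℂ, w ^ p = 1 → ∀ a : ℕ,
      (if Nat.gcd a k = 1 then w ^ a else 0) - (if Nat.gcd a (p ^ 2 * k) = 1 then w ^ a else 0)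
        = if Nat.gcd a k = 1 ∧ p ∣ a then (1 : ℂ) else 0 := by
    intro w hw a
    have hiff : Nat.gcd a (p ^ 2 * k) = 1 ↔ ¬ p ∣ a ∧ Nat.gcd a k = 1 := by
      rw [← hp.coprime_iff_not_dvd, ← Nat.coprime_iff_gcd_eq_one, ← Nat.coprime_iff_gcd_eq_one,
        Nat.coprime_mul_iff_right, Nat.coprime_pow_right_iff (by norm_num), Nat.coprime_comm]
    by_cases h1 : Nat.gcd a k = 1 <;> by_cases h2 : p ∣ a <;> simp [hiff, h1, h2]
    obtain ⟨b, rfl⟩ := h2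
    rw [pow_mul, hw, one_pow]
  have e1 := Finset.sum_congr (rfl : Finset.range (p ^ 2 * k) = _) fun a _ => key z hzp a
  have e2 := Finset.sum_congr (rfl : Finset.range (p ^ 2 * k) = _)
    fun a _ => key 1 (one_pow _) a
  rw [Finset.sum_sub_distrib, sum_coprime_pow] at e1 e2
  rw [sum_totient, sum_totient] at e2
  have hgeom : ∑ s ∈ Finset.range (p ^ 2), (z ^ k) ^ s = 0 := by
    rw [geom_sum_eq hzk, ← pow_mul, mul_comm k, pow_two, mul_assoc, pow_mul, hzp]
    simp
  have htot : (p ^ 2 * k).totient = p * (p - 1) * k.totient := by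
    rw [Nat.totient_mul (Nat.Coprime.pow_left 2 hk), Nat.totient_prime_pow hp (by norm_num)]
    simp
  rw [hgeom, zero_mul, zero_sub] at e1
  rw [htot] at e2
  simp only [one_pow, Finset.sum_const, Finset.card_range, nsmul_eq_mul, mul_one] at e2
  push_cast [Nat.cast_sub hp.one_le] at e2
  linear_combination e2 - e1

theorem stmt8 (p q : ℕ) (hp : p.Prime) (hq : q.Prime)
    (hpo : Odd p) (hqo : Odd q) (hpq : p ≠ q) :
    lamStar p q (p * q ^ 3)
      = ((((p : ℤ) - 1) * (2 - 2 * (q : ℤ) + 2 * (q : ℤ) ^ 2 - (q : ℤ) ^ 3) : ℤ) : ℂ) := by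
  have hc : p.Coprime q := (Nat.coprime_primes hp hq).2 hpq
  have hp0 := hp.pos
  have hq0 := hq.pos
  have hpd : ¬ p ∣ q := fun h => hpq ((Nat.prime_dvd_prime_iff_eq hp hq).1 h)
  have hqd : ¬ q ∣ p := fun h => hpq ((Nat.prime_dvd_prime_iff_eq hq hp).1 h).symm
  have hpdq : ∀ i, ¬ p ∣ q ^ i := fun i h => hpd (hp.dvd_of_dvd_pow h)
  have hqdp : ∀ i, ¬ q ∣ p ^ i := fun i h => hqd (hq.dvd_of_dvd_pow h)
  have inj : ∀ a b c d : ℕ, p ^ a * q ^ b = p ^ c * q ^ d → a = c ∧ b = d := by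
    intro a b c d h
    have h1 := congrArg (fun n => n.factorization p) h
    have h2 := congrArg (fun n => n.factorization q) h
    simp [Nat.factorization_mul, hp.ne_zero, hq.ne_zero, hp.factorization, hq.factorization,
      hpq, hpq.symm] at h1 h2
    exact ⟨h1, h2⟩
  have n1 : 1 ∉ ({p ^ 2, p * q, q ^ 2, p ^ 2 * q ^ 2, p * q ^ 3} : Finset ℕ) := by
    have i1 := inj 0 0 2 0
    have i2 := inj 0 0 1 1
    have i3 := inj 0 0 0 2
    have i4 := inj 0 0 2 2
    have i5 := inj 0 0 1 3
    simp only [pow_zero, pow_one, one_mul, mul_one] at i1 i2 i3 i4 i5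
    simp only [Finset.mem_insert, Finset.mem_singleton]
    omega
  have n2 : p ^ 2 ∉ ({p * q, q ^ 2, p ^ 2 * q ^ 2, p * q ^ 3} : Finset ℕ) := by
    have i2 := inj 2 0 1 1
    have i3 := inj 2 0 0 2
    have i4 := inj 2 0 2 2
    have i5 := inj 2 0 1 3
    simp only [pow_zero, pow_one, one_mul, mul_one] at i2 i3 i4 i5
    simp only [Finset.mem_insert, Finset.mem_singleton]
    omega
  have n3 : p * q ∉ ({q ^ 2, p ^ 2 * q ^ 2, p * q ^ 3} : Finset ℕ) := by
    have i3 := inj 1 1 0 2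
    have i4 := inj 1 1 2 2
    have i5 := inj 1 1 1 3
    simp only [pow_zero, pow_one, one_mul] at i3 i4 i5
    simp only [Finset.mem_insert, Finset.mem_singleton]
    omega
  have n4 : q ^ 2 ∉ ({p ^ 2 * q ^ 2, p * q ^ 3} : Finset ℕ) := by
    have i4 := inj 0 2 2 2
    have i5 := inj 0 2 1 3
    simp only [pow_zero, pow_one, one_mul] at i4 i5
    simp only [Finset.mem_insert, Finset.mem_singleton]
    omega
  have n5 : p ^ 2 * q ^ 2 ∉ ({p * q ^ 3} : Finset ℕ) := by
    have i5 := inj 2 2 1 3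
    simp only [pow_one] at i5
    simp only [Finset.mem_singleton]
    omega
  rw [lamStar, Dstar, Finset.sum_insert n1, Finset.sum_insert n2, Finset.sum_insert n3,
    Finset.sum_insert n4, Finset.sum_insert n5, Finset.sum_singleton]
  have d2 : p ^ 2 * q ^ 3 / p ^ 2 = q ^ 3 := Nat.div_eq_of_eq_mul_right (by positivity) (by ring)
  have d3 : p ^ 2 * q ^ 3 / (p * q) = p * q ^ 2 :=
    Nat.div_eq_of_eq_mul_right (by positivity) (by ring)
  have d4 : p ^ 2 * q ^ 3 / q ^ 2 = p ^ 2 * q :=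
    Nat.div_eq_of_eq_mul_right (by positivity) (by ring)
  have d5 : p ^ 2 * q ^ 3 / (p ^ 2 * q ^ 2) = q :=
    Nat.div_eq_of_eq_mul_right (by positivity) (by ring)
  have d6 : p ^ 2 * q ^ 3 / (p * q ^ 3) = p :=
    Nat.div_eq_of_eq_mul_right (by positivity) (by ring)
  rw [Nat.div_one, d2, d3, d4, d5, d6]
  have r1 := ramanujan_sq p (q ^ 3) 1 hp (hc.pow_right 3) (by positivity) (Nat.coprime_one_right p)
  have r4 := ramanujan_sq p q (q ^ 2) hp hc hq.ne_zero (hc.pow_right 2)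
  rw [mul_one] at r1
  rw [show p * q * q ^ 2 = p * q ^ 3 by ring] at r4
  rw [r1, r4, ramanujan_dvd _ (q ^ 3) (by positivity) ⟨p, by ring⟩,
    ramanujan_dvd _ (p * q ^ 2) (by positivity) ⟨q, by ring⟩,
    ramanujan_dvd _ q (by positivity) ⟨p * q ^ 2, by ring⟩,
    ramanujan_dvd _ p (by positivity) ⟨q ^ 3, by ring⟩,
    Nat.totient_mul (hc.pow_right 2), Nat.totient_prime_pow hq (by norm_num),
    Nat.totient_prime_pow hq (by norm_num), Nat.totient_prime hp, Nat.totient_prime hq]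
  push_cast [Nat.cast_sub hp.one_le, Nat.cast_sub hq.one_le]
  norm_num
  ring
end

section
/- Let p and q be distinct odd primes, n = p²q³, and D* = {1, p², pq, q², p²q², pq³}. Then the eigenvalue at the divisor p²q³ = n satisfies λ_{p²q³}(D*) = ∑_{d ∈ D*} c(p²q³, n/d) = (p²-2p+2)(q-1)(q²+1) + (p-1)q³ (equality in ℂ with the integer right-hand side coerced). -/
lemma ram_totient (j m : ℕ) (hm : 0 < m) (h : m ∣ j) :
    ramanujanSum j m = (Nat.totient m : ℂ) := by
  obtain ⟨k, rfl⟩ := h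
  unfold ramanujanSum
  have hm' : (m : ℂ) ≠ 0 := by exact_mod_cast hm.ne'
  have h1 : ∀ a ∈ (Finset.Icc 1 m).filter (fun a => Nat.gcd a m = 1),
      Complex.exp (2 * (Real.pi : ℂ) * Complex.I * (a : ℂ) * ((m * k : ℕ) : ℂ) / (m : ℂ)) = 1 := by
    intro a _
    rw [Complex.exp_eq_one_iff]
    refine ⟨(a * k : ℕ), ?_⟩
    push_cast
    field_simp
  rw [Finset.sum_congr rfl h1, Finset.sum_const, nsmul_eq_mul, mul_one]
  congr 1
  unfold Nat.totient
  rcases Nat.lt_or_ge 1 m with h1 | h1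
  · congr 1
    ext a
    simp only [Finset.mem_filter, Finset.mem_Icc, Finset.mem_range, Nat.coprime_iff_gcd_eq_one]
    constructor
    · rintro ⟨⟨h2, h3⟩, h4⟩
      refine ⟨lt_of_le_of_ne h3 ?_, Nat.gcd_comm a m ▸ h4⟩
      rintro rfl
      simp at h4
      omega
    · rintro ⟨h2, h4⟩
      refine ⟨⟨?_, h2.le⟩, Nat.gcd_comm a m ▸ h4⟩
      rcases Nat.eq_zero_or_pos a with rfl | h5
      · simp at h4
        omega
      · exact h5
  · obtain rfl : m = 1 := by omega
    decide

lemma exps_eq {p q : ℕ} (hp : p.Prime) (hq : q.Prime) (hpq : p ≠ q) {a b c d : ℕ}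
    (h : p ^ a * q ^ b = p ^ c * q ^ d) : a = c ∧ b = d := by
  have key : ∀ x y : ℕ, (p ^ x * q ^ y).factorization p = x ∧
      (p ^ x * q ^ y).factorization q = y := by
    intro x y
    rw [Nat.factorization_mul (pow_ne_zero _ hp.ne_zero) (pow_ne_zero _ hq.ne_zero),
      hp.factorization_pow, hq.factorization_pow]
    simp [hpq, hpq.symm]
  have h1 := key a b
  have h2 := key c d
  rw [h] at h1
  omega

theorem stmt9 (p q : ℕ) (hp : p.Prime) (hq : q.Prime)
    (hpo : Odd p) (hqo : Odd q) (hpq : p ≠ q) :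
    lamStar p q (p ^ 2 * q ^ 3)
      = ((((p : ℤ) ^ 2 - 2 * (p : ℤ) + 2) * ((q : ℤ) - 1) * ((q : ℤ) ^ 2 + 1)
          + ((p : ℤ) - 1) * (q : ℤ) ^ 3 : ℤ) : ℂ) := by
  have hD : Dstar p q = (({(0,0),(2,0),(1,1),(0,2),(2,2),(1,3)} : Finset (ℕ × ℕ))).image
      (fun x => p ^ x.1 * q ^ x.2) := by
    simp [Dstar, Finset.image_insert]
  have hp0 := hp.pos
  have hq0 := hq.pos
  have term : ∀ a b a' b' : ℕ, a + a' = 2 → b + b' = 3 →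
      ramanujanSum (p ^ 2 * q ^ 3) (p ^ 2 * q ^ 3 / (p ^ a * q ^ b))
        = ((p ^ a').totient : ℂ) * ((q ^ b').totient : ℂ) := by
    intro a b a' b' ha hb
    have h1 : p ^ 2 * q ^ 3 = (p ^ a * q ^ b) * (p ^ a' * q ^ b') := by
      rw [← ha, ← hb]; ring
    have h2 : p ^ 2 * q ^ 3 / (p ^ a * q ^ b) = p ^ a' * q ^ b' := by
      rw [h1]; exact Nat.mul_div_cancel_left _ (by positivity)
    rw [h2, ram_totient _ _ (by positivity) ⟨_, h1.trans (mul_comm _ _)⟩,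
      Nat.totient_mul (Nat.Coprime.pow _ _ ((Nat.coprime_primes hp hq).2 hpq))]
    push_cast
    rfl
  have tp : ∀ r : ℕ, r.Prime → ∀ k : ℕ,
      ((r ^ (k+1)).totient : ℂ) = (r : ℂ) ^ k * ((r : ℂ) - 1) := by
    intro r hr k
    rw [Nat.totient_prime_pow_succ hr, Nat.cast_mul, Nat.cast_pow, Nat.cast_sub hr.one_le,
      Nat.cast_one]
  unfold lamStar
  rw [hD, Finset.sum_image]
  · rw [Finset.sum_insert (by decide), Finset.sum_insert (by decide), Finset.sum_insert (by decide),
      Finset.sum_insert (by decide), Finset.sum_insert (by decide), Finset.sum_singleton]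
    dsimp only
    rw [term 0 0 2 3 rfl rfl, term 2 0 0 3 rfl rfl, term 1 1 1 2 rfl rfl, term 0 2 2 1 rfl rfl,
      term 2 2 0 1 rfl rfl, term 1 3 1 0 rfl rfl]
    rw [tp p hp 1, tp p hp 0, tp q hq 2, tp q hq 1, tp q hq 0]
    simp only [pow_zero, Nat.totient_one, Nat.cast_one]
    push_cast
    ring
  · rintro ⟨a, b⟩ _ ⟨c, d⟩ _ h
    obtain ⟨h1, h2⟩ := exps_eq hp hq hpq h
    exact Prod.ext h1 h2
end
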